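/- arXiv:1705.07918 — 2 statements merged into one kernel-verified Lean document; each statement's English description precedes it below -/
import Mathlib

section
/- Let e be an empirical model on a measurement scenario (X, M, O) with 0 < NCF(e) < 1. Then there exist a non-contextual empirical model e^NC and a strongly contextual empirical model e^SC on (X, M, O) such that e_C = NCF(e) · e^NC_C + CF(e) · e^SC_C for every C ∈ M. Moreover, in any decomposition e = NCF(e) · e^NC + CF(e) · e' with e^NC non-contextual and e' an empirical model, the model e' is necessarily strongly contextual. -/
open Finset

/-- Assignments of outcomes in `O` to the measurements in a context `C`. -/
abbrev Assign {X : Type} (C : Finset X) (O : Type) : Type := {x // x ∈ C} → O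

variable {X O : Type} [Fintype X] [DecidableEq X] [Fintype O] [DecidableEq O]

/-- Marginalisation of a distribution on assignments on `C` to a subset `U ⊆ C`. -/
noncomputable def marg {C U : Finset X} (h : U ⊆ C) (d : Assign C O → ℝ) :
    Assign U O → ℝ :=
  fun t => ∑ s ∈ univ.filter
    (fun s : Assign C O => ∀ u : {x // x ∈ U}, s ⟨u.1, h u.2⟩ = t u), d s

/-- Marginalisation of a distribution on global assignments to a context `C`. -/
noncomputable def margG (C : Finset X) (d : (X → O) → ℝ) : Assign C O → ℝ :=
  fun t => ∑ g ∈ univ.filter (fun g : X → O => ∀ x : {x // x ∈ C}, g x.1 = t x), d g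

/-- `d` is a probability distribution on the finite type `α`. -/
def IsProb {α : Type} [Fintype α] (d : α → ℝ) : Prop :=
  (∀ a, 0 ≤ d a) ∧ ∑ a, d a = 1

/-- An empirical model on the scenario `(X, M, O)`: a probability distribution on each
context of `M`, compatible on overlaps. -/
def IsEmpiricalModel (M : Finset (Finset X)) (e : ∀ C : Finset X, Assign C O → ℝ) : Prop :=
  (∀ C ∈ M, IsProb (e C)) ∧
  ∀ C ∈ M, ∀ C' ∈ M,
    marg (inter_subset_left : C ∩ C' ⊆ C) (e C) =
    marg (inter_subset_right : C ∩ C' ⊆ C') (e C')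

/-- A model is non-contextual if it is the marginalisation of a probability
distribution on global assignments. -/
def NonContextual (M : Finset (Finset X)) (e : ∀ C : Finset X, Assign C O → ℝ) : Prop :=
  ∃ d : (X → O) → ℝ, IsProb d ∧ ∀ C ∈ M, margG C d = e C

/-- A model is strongly contextual if no global assignment is consistent with its support. -/
def StronglyContextual (M : Finset (Finset X)) (e : ∀ C : Finset X, Assign C O → ℝ) : Prop :=
  ¬ ∃ g : X → O, ∀ C ∈ M, 0 < e C (fun x => g x.1)

/-- `b` is a subprobability distribution on global assignments whose marginals are
  dominated by the empirical model `e`. -/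
def Feasible (M : Finset (Finset X)) (e : ∀ C : Finset X, Assign C O → ℝ)
    (b : (X → O) → ℝ) : Prop :=
  (∀ g, 0 ≤ b g) ∧ (∑ g, b g) ≤ 1 ∧ ∀ C ∈ M, ∀ t, margG C b t ≤ e C t

/-- The non-contextual fraction: the maximum weight of a subprobability distribution on
global assignments dominated by `e`. -/
noncomputable def NCF (M : Finset (Finset X)) (e : ∀ C : Finset X, Assign C O → ℝ) : ℝ :=
  sSup {w | ∃ b : (X → O) → ℝ, Feasible M e b ∧ ∑ g, b g = w}

/-- The contextual fraction. -/
noncomputable def CF (M : Finset (Finset X)) (e : ∀ C : Finset X, Assign C O → ℝ) : ℝ :=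
  1 - NCF M e

lemma margG_apply (C : Finset X) (d : (X → O) → ℝ) (t : Assign C O) :
    margG C d t = ∑ g, if (fun x : {x // x ∈ C} => g x.1) = t then d g else 0 := by
  simp only [margG, sum_filter, funext_iff]

lemma marg_apply {Y : Type} [DecidableEq Y] {C U : Finset Y} (h : U ⊆ C) (d : Assign C O → ℝ) (t : Assign U O) :
    marg h d t =
      ∑ s, if (fun u : {x // x ∈ U} => s ⟨u.1, h u.2⟩) = t then d s else 0 := by
  simp only [marg, sum_filter, funext_iff]

lemma sum_margG (C : Finset X) (d : (X → O) → ℝ) : ∑ t, margG C d t = ∑ g, d g := by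
  simp only [margG_apply]
  rw [sum_comm]
  simp

lemma marg_margG {C U : Finset X} (h : U ⊆ C) (d : (X → O) → ℝ) :
    marg h (margG C d) = margG U d := by
  funext t
  simp only [marg_apply, margG_apply, ← sum_filter (s := (univ : Finset (Assign C O)))]
  rw [sum_comm]
  refine sum_congr rfl fun g _ => ?_
  simp [sum_ite_eq]

lemma margG_nonneg (C : Finset X) {d : (X → O) → ℝ} (hd : ∀ g, 0 ≤ d g) (t : Assign C O) :
    0 ≤ margG C d t :=
  sum_nonneg fun g _ => hd g

lemma margG_mul (C : Finset X) (c : ℝ) (d : (X → O) → ℝ) (t : Assign C O) :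
    margG C (fun g => c * d g) t = c * margG C d t := by
  simp only [margG, mul_sum]

lemma margG_add (C : Finset X) (d d' : (X → O) → ℝ) (t : Assign C O) :
    margG C (fun g => d g + d' g) t = margG C d t + margG C d' t := by
  simp only [margG, sum_add_distrib]

lemma margG_single (C : Finset X) (g : X → O) (c : ℝ) (t : Assign C O) :
    margG C (Pi.single g c) t = if (fun x : {x // x ∈ C} => g x.1) = t then c else 0 := by
  rw [margG_apply, sum_eq_single g]
  · simp
  · intro b _ hb
    simp [hb]
  · simp

lemma marg_mul_sub {Y : Type} [DecidableEq Y] {C U : Finset Y} (h : U ⊆ C) (c : ℝ)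
    (d d' : Assign C O → ℝ) :
    marg h (fun s => c * (d s - d' s)) = fun t => c * (marg h d t - marg h d' t) := by
  funext t
  simp only [marg, ← sum_sub_distrib, mul_sum]

lemma isEmpiricalModel_margG (M : Finset (Finset X)) {d : (X → O) → ℝ} (hd : IsProb d) :
    IsEmpiricalModel M (fun C => margG C d) :=
  ⟨fun C _ => ⟨margG_nonneg C hd.1, (sum_margG C d).trans hd.2⟩,
    fun C _ C' _ => by simp only [marg_margG]⟩

lemma le_NCF {M : Finset (Finset X)} {e : ∀ C : Finset X, Assign C O → ℝ}
    {b : (X → O) → ℝ} (hb : Feasible M e b) : ∑ g, b g ≤ NCF M e :=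
  le_csSup ⟨1, by rintro _ ⟨b', hb', rfl⟩; exact hb'.2.1⟩ ⟨b, hb, rfl⟩

lemma isCompact_feasible (M : Finset (Finset X)) (e : ∀ C : Finset X, Assign C O → ℝ) :
    IsCompact {b | Feasible M e b} := by
  refine (isCompact_Icc (a := (0 : (X → O) → ℝ)) (b := 1)).of_isClosed_subset ?_ ?_
  · have hset : {b | Feasible M e b} = {b | ∀ g, 0 ≤ b g} ∩ ({b | ∑ g, b g ≤ 1} ∩
        {b | ∀ C ∈ M, ∀ t, margG C b t ≤ e C t}) := rfl
    rw [hset]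
    simp only [Set.ofPred_forall, margG]
    refine (isClosed_iInter fun g => ?_).inter (IsClosed.inter ?_
      (isClosed_iInter fun C => isClosed_iInter fun _ => isClosed_iInter fun t => ?_))
    · exact isClosed_le (by fun_prop) (by fun_prop)
    · exact isClosed_le (by fun_prop) (by fun_prop)
    · exact isClosed_le (by fun_prop) (by fun_prop)
  · intro b hb
    exact ⟨hb.1, fun g => (single_le_sum (fun i _ => hb.1 i) (mem_univ g)).trans hb.2.1⟩

lemma exists_feasible_sum_eq_NCF {M : Finset (Finset X)}
    {e : ∀ C : Finset X, Assign C O → ℝ} (he : IsEmpiricalModel M e) :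
    ∃ b, Feasible M e b ∧ ∑ g, b g = NCF M e := by
  have hne : {b | Feasible M e b}.Nonempty :=
    ⟨0, fun _ => le_rfl, by simp, fun C hC t => by simpa [margG] using (he.1 C hC).1 t⟩
  obtain ⟨b, hb, hmax⟩ := (isCompact_feasible M e).exists_isMaxOn hne
    (f := fun b => ∑ g, b g) (by fun_prop)
  refine ⟨b, hb, le_antisymm (le_NCF hb) (csSup_le ⟨_, b, hb, rfl⟩ ?_)⟩
  rintro _ ⟨b', hb', rfl⟩
  exact hmax hb'

lemma exists_pos_le_on_finset {ι : Type*} (s : Finset ι) (f : ι → ℝ)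
    (hf : ∀ i ∈ s, 0 < f i) : ∃ δ, 0 < δ ∧ δ ≤ 1 ∧ ∀ i ∈ s, δ ≤ f i := by
  classical
  induction s using Finset.induction_on with
  | empty => exact ⟨1, one_pos, le_rfl, by simp⟩
  | insert a s _ ih =>
    obtain ⟨δ, h0, h1, h⟩ := ih fun i hi => hf i (mem_insert_of_mem hi)
    refine ⟨min δ (f a), lt_min h0 (hf a (mem_insert_self a s)), (min_le_left _ _).trans h1, ?_⟩
    intro i hi
    rcases mem_insert.1 hi with rfl | hi
    · exact min_le_right _ _
    · exact (min_le_left _ _).trans (h i hi)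

lemma stronglyContextual_of_decomposition {M : Finset (Finset X)}
    {e eNC e' : ∀ C : Finset X, Assign C O → ℝ} (h0 : 0 ≤ NCF M e) (h1 : NCF M e < 1)
    (hNC : NonContextual M eNC) (he' : IsEmpiricalModel M e')
    (h : ∀ C ∈ M, ∀ s, e C s = NCF M e * eNC C s + CF M e * e' C s) :
    StronglyContextual M e' := by
  rintro ⟨g, hg⟩
  obtain ⟨d, hd, hdM⟩ := hNC
  obtain ⟨δ, hδ0, hδ1, hδ⟩ := exists_pos_le_on_finset M _ hg
  have hCF : 0 < CF M e := sub_pos.2 h1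
  have hsingle : ∀ g', 0 ≤ (Pi.single g δ : (X → O) → ℝ) g' := fun g' =>
    (Pi.single_nonneg.2 hδ0.le : (0 : (X → O) → ℝ) ≤ Pi.single g δ) g'
  have hsum : ∑ g', (NCF M e * d g' + CF M e * (Pi.single g δ : (X → O) → ℝ) g') =
      NCF M e + CF M e * δ := by
    rw [sum_add_distrib, ← mul_sum, ← mul_sum, hd.2, mul_one,
      Finset.sum_pi_single', if_pos (mem_univ g)]
  have hfeas : Feasible M e
      (fun g' => NCF M e * d g' + CF M e * (Pi.single g δ : (X → O) → ℝ) g') := by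
    refine ⟨fun g' => add_nonneg (mul_nonneg h0 (hd.1 g')) (mul_nonneg hCF.le (hsingle g')),
      ?_, fun C hC t => ?_⟩
    · rw [hsum]
      have := mul_le_of_le_one_right hCF.le hδ1
      unfold CF at *
      linarith
    · rw [margG_add, margG_mul, margG_mul, margG_single, hdM C hC, h C hC t]
      gcongr
      split_ifs with ht
      · exact ht ▸ hδ C hC
      · exact (he'.1 C hC).1 t
  have := le_NCF hfeas
  rw [hsum] at this
  linarith [mul_pos hCF hδ0]

lemma exists_decomposition {M : Finset (Finset X)} {e : ∀ C : Finset X, Assign C O → ℝ}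
    (he : IsEmpiricalModel M e) (h0 : 0 < NCF M e) (h1 : NCF M e < 1) :
    ∃ eNC e' : ∀ C : Finset X, Assign C O → ℝ,
      IsEmpiricalModel M eNC ∧ NonContextual M eNC ∧ IsEmpiricalModel M e' ∧
      ∀ C ∈ M, ∀ s, e C s = NCF M e * eNC C s + CF M e * e' C s := by
  obtain ⟨b, hb, hbsum⟩ := exists_feasible_sum_eq_NCF he
  have hCF : 0 < CF M e := sub_pos.2 h1
  have hd : IsProb (fun g => (NCF M e)⁻¹ * b g) :=
    ⟨fun g => mul_nonneg (inv_nonneg.2 h0.le) (hb.1 g), by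
      rw [← mul_sum, hbsum, inv_mul_cancel₀ h0.ne']⟩
  refine ⟨fun C => margG C fun g => (NCF M e)⁻¹ * b g,
    fun C s => (CF M e)⁻¹ * (e C s - margG C b s), isEmpiricalModel_margG M hd,
    ⟨_, hd, fun _ _ => rfl⟩, ⟨fun C hC => ⟨fun s => ?_, ?_⟩, fun C hC C' hC' => ?_⟩,
    fun C hC s => ?_⟩
  · exact mul_nonneg (inv_nonneg.2 hCF.le) (sub_nonneg.2 (hb.2.2 C hC s))
  · rw [← mul_sum, sum_sub_distrib, (he.1 C hC).2, sum_margG, hbsum]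
    exact inv_mul_cancel₀ hCF.ne'
  · rw [marg_mul_sub, marg_mul_sub, he.2 C hC C' hC', marg_margG, marg_margG]
  · dsimp only
    rw [margG_mul, mul_inv_cancel_left₀ h0.ne', mul_inv_cancel_left₀ hCF.ne']
    ring

/-- Any empirical model with `0 < NCF(e) < 1` decomposes as
`e = NCF(e)·e^NC + CF(e)·e^SC` with `e^NC` non-contextual and `e^SC` strongly
contextual; moreover in any such decomposition with maximal non-contextual weight the
other part is necessarily strongly contextual. -/
theorem decomposition_noncontextual_stronglycontextual
    {X O : Type} [Fintype X] [DecidableEq X] [Fintype O] [DecidableEq O] [Nonempty O]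
    (M : Finset (Finset X)) (e : ∀ C : Finset X, Assign C O → ℝ)
    (he : IsEmpiricalModel M e) (h0 : 0 < NCF M e) (h1 : NCF M e < 1) :
    (∃ eNC eSC : ∀ C : Finset X, Assign C O → ℝ,
      IsEmpiricalModel M eNC ∧ NonContextual M eNC ∧
      IsEmpiricalModel M eSC ∧ StronglyContextual M eSC ∧
      ∀ C ∈ M, ∀ s, e C s = NCF M e * eNC C s + CF M e * eSC C s) ∧
    (∀ eNC e' : ∀ C : Finset X, Assign C O → ℝ,
      IsEmpiricalModel M eNC → NonContextual M eNC → IsEmpiricalModel M e' →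
      (∀ C ∈ M, ∀ s, e C s = NCF M e * eNC C s + CF M e * e' C s) →
      StronglyContextual M e') := by
  refine ⟨?_, fun eNC e' _ hNC he' h =>
    stronglyContextual_of_decomposition h0.le h1 hNC he' h⟩
  obtain ⟨eNC, e', hm, hNC, he', h⟩ := exists_decomposition he h0 h1
  exact ⟨eNC, e', hm, hNC, he',
    stronglyContextual_of_decomposition h0.le h1 hNC he' h, h⟩
end

section
/- (Theorem 2, controlled choice) Let e₁ and e₂ be empirical models on measurement scenarios (X₁, M₁, O) and (X₂, M₂, O) respectively, with X₁ and X₂ disjoint. Define the empirical model e₁ & e₂ on the scenario (X₁ ⊔ X₂, M₁ ⊔ M₂, O), where each context of M₁ or M₂ is viewed as a subset of X₁ ⊔ X₂, by (e₁ & e₂)_C = (e₁)_C for C ∈ M₁ and (e₁ & e₂)_C = (e₂)_C for C ∈ M₂. Then NCF(e₁ & e₂) = min{NCF(e₁), NCF(e₂)}; equivalently CF(e₁ & e₂) = max{CF(e₁), CF(e₂)}. -/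
open Finset

variable {X O : Type} [Fintype X] [DecidableEq X] [Fintype O] [DecidableEq O]

/-- The contexts of `M₁` viewed as contexts on `X₁ ⊕ X₂`. -/
def inlContexts {X₁ X₂ : Type} [DecidableEq X₁] [DecidableEq X₂]
    (M₁ : Finset (Finset X₁)) : Finset (Finset (X₁ ⊕ X₂)) :=
  M₁.image (Finset.map ⟨Sum.inl, Sum.inl_injective⟩)

/-- The contexts of `M₂` viewed as contexts on `X₁ ⊕ X₂`. -/
def inrContexts {X₁ X₂ : Type} [DecidableEq X₁] [DecidableEq X₂]
    (M₂ : Finset (Finset X₂)) : Finset (Finset (X₁ ⊕ X₂)) :=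
  M₂.image (Finset.map ⟨Sum.inr, Sum.inr_injective⟩)

/-- The controlled choice `e₁ & e₂` of two empirical models on disjoint sets of
measurements, a model on the scenario `(X₁ ⊔ X₂, M₁ ⊔ M₂, O)`: on a context coming from
`M₁` it behaves as `e₁`, and on a context coming from `M₂` it behaves as `e₂`.
(On the empty context every empirical model takes the value `1`.) -/
noncomputable def choiceModel {X₁ X₂ O : Type} [Fintype X₁] [DecidableEq X₁]
    [Fintype X₂] [DecidableEq X₂] [Fintype O] [DecidableEq O]
    (M₁ : Finset (Finset X₁))
    (e₁ : ∀ C₁ : Finset X₁, Assign C₁ O → ℝ) (e₂ : ∀ C₂ : Finset X₂, Assign C₂ O → ℝ) :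
    ∀ C : Finset (X₁ ⊕ X₂), Assign C O → ℝ :=
  fun C s =>
    if C = ∅ then 1
    else if C ∈ (inlContexts M₁ : Finset (Finset (X₁ ⊕ X₂))) then
      e₁ C.toLeft (fun x => s ⟨Sum.inl x.1, Finset.mem_toLeft.mp x.2⟩)
    else
      e₂ C.toRight (fun x => s ⟨Sum.inr x.1, Finset.mem_toRight.mp x.2⟩)

section Embedding

variable {Y Z : Type}

/-- Assignments on the image of a context under an embedding of measurements, seen as
assignments on the context itself. -/
noncomputable def assignMapEquiv (f : Y ↪ Z) (C : Finset Y) (O : Type) :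
    Assign (C.map f) O ≃ Assign C O :=
  Equiv.arrowCongr (C.equivMap f).symm (Equiv.refl O)

/-- The model `E` restricts to `e` on the images under `f` of the contexts in `M`. -/
def RestrictsTo {O : Type} (f : Y ↪ Z) (M : Finset (Finset Y))
    (E : ∀ C : Finset Z, Assign C O → ℝ) (e : ∀ C : Finset Y, Assign C O → ℝ) : Prop :=
  ∀ C ∈ M, ∀ s, E (C.map f) s = e C (assignMapEquiv f C O s)

variable {O : Type} [Fintype O] [DecidableEq O] [DecidableEq Y] [DecidableEq Z]

theorem marg_map (f : Y ↪ Z) {C U' : Finset Y} {U : Finset Z} (hU : U = U'.map f)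
    (h : U ⊆ C.map f) (h' : U' ⊆ C) (d : Assign C O → ℝ) (t : Assign U O) :
    marg h (fun s => d (assignMapEquiv f C O s)) t =
      marg h' d (fun u => t ⟨f u.1, hU ▸ Finset.mem_map_of_mem f u.2⟩) := by
  subst hU
  refine Finset.sum_equiv (assignMapEquiv f C O) (fun s => ?_) (fun _ _ => rfl)
  simp only [mem_filter, mem_univ, true_and]
  refine ⟨fun hs u => hs ⟨f u.1, Finset.mem_map_of_mem f u.2⟩, ?_⟩
  rintro hs ⟨_, hu⟩
  obtain ⟨u, hu', rfl⟩ := Finset.mem_map.mp hu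
  exact hs ⟨u, hu'⟩

theorem marg_eq_sum_of_eq_empty {C U : Finset Y} (hU : U = ∅) (h : U ⊆ C)
    (d : Assign C O → ℝ) (t : Assign U O) : marg h d t = ∑ s, d s := by
  subst hU
  simp [marg]

theorem RestrictsTo.isProb {f : Y ↪ Z} {M : Finset (Finset Y)}
    {E : ∀ C : Finset Z, Assign C O → ℝ} {e : ∀ C : Finset Y, Assign C O → ℝ}
    (hE : RestrictsTo f M E e) (he : IsEmpiricalModel M e) {C : Finset Y} (hC : C ∈ M) :
    IsProb (E (C.map f)) := by
  refine ⟨fun s => ?_, ?_⟩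
  · rw [hE C hC]
    exact (he.1 C hC).1 _
  · simp only [hE C hC]
    rw [Equiv.sum_comp (assignMapEquiv f C O) (e C)]
    exact (he.1 C hC).2

theorem RestrictsTo.marg_inter_eq {f : Y ↪ Z} {M : Finset (Finset Y)}
    {E : ∀ C : Finset Z, Assign C O → ℝ} {e : ∀ C : Finset Y, Assign C O → ℝ}
    (hE : RestrictsTo f M E e) (he : IsEmpiricalModel M e) {C C' : Finset Y} (hC : C ∈ M)
    (hC' : C' ∈ M) :
    marg (inter_subset_left : C.map f ∩ C'.map f ⊆ C.map f) (E (C.map f)) =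
      marg (inter_subset_right : C.map f ∩ C'.map f ⊆ C'.map f) (E (C'.map f)) := by
  have hU : C.map f ∩ C'.map f = (C ∩ C').map f := (Finset.map_inter C C').symm
  funext t
  rw [funext (hE C hC), funext (hE C' hC'), marg_map f hU _ inter_subset_left,
    marg_map f hU _ inter_subset_right, he.2 C hC C' hC']

theorem IsEmpiricalModel.apply_empty {M : Finset (Finset Y)}
    {e : ∀ C : Finset Y, Assign C O → ℝ} (he : IsEmpiricalModel M e) {C : Finset Y}
    (hC : C ∈ M) (h : C = ∅) (s : Assign C O) : e C s = 1 := by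
  subst h
  rw [← (he.1 ∅ hC).2, Fintype.sum_eq_single s fun t ht => (ht (Subsingleton.elim t s)).elim]

variable [Fintype Y] [Fintype Z]

/-- The pushforward of a distribution on global assignments along restriction of assignments. -/
noncomputable def restrictAlong (f : Y ↪ Z) (b : (Z → O) → ℝ) : (Y → O) → ℝ :=
  fun h => ∑ g ∈ univ.filter (fun g : Z → O => g ∘ f = h), b g

theorem sum_restrictAlong (f : Y ↪ Z) (b : (Z → O) → ℝ) :
    ∑ h, restrictAlong f b h = ∑ g, b g :=
  Finset.sum_fiberwise univ (fun g : Z → O => g ∘ f) b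

theorem margG_map (f : Y ↪ Z) (b : (Z → O) → ℝ) (C : Finset Y) (s : Assign (C.map f) O) :
    margG (C.map f) b s = margG C (restrictAlong f b) (assignMapEquiv f C O s) := by
  unfold margG restrictAlong
  rw [Finset.sum_fiberwise_eq_sum_filter]
  refine Finset.sum_congr ?_ fun _ _ => rfl
  ext g
  simp only [mem_filter, mem_univ, true_and]
  refine ⟨fun hs x => hs ⟨f x.1, Finset.mem_map_of_mem f x.2⟩, ?_⟩
  rintro hs ⟨_, hx⟩
  obtain ⟨x, hx', rfl⟩ := Finset.mem_map.mp hx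
  exact hs ⟨x, hx'⟩

theorem margG_mono (C : Finset Y) {b b' : (Y → O) → ℝ} (h : ∀ g, b g ≤ b' g)
    (t : Assign C O) : margG C b t ≤ margG C b' t :=
  Finset.sum_le_sum fun g _ => h g

theorem feasible_zero {M : Finset (Finset Y)} {e : ∀ C : Finset Y, Assign C O → ℝ}
    (he : IsEmpiricalModel M e) : Feasible M e (fun _ => 0) :=
  ⟨fun _ => le_rfl, by simp, fun C hC t => by simpa [margG] using (he.1 C hC).1 t⟩

theorem bddAbove_feasible_weights (M : Finset (Finset Y)) (e : ∀ C : Finset Y, Assign C O → ℝ) :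
    BddAbove {w | ∃ b : (Y → O) → ℝ, Feasible M e b ∧ ∑ g, b g = w} :=
  ⟨1, by rintro _ ⟨b, hb, rfl⟩; exact hb.2.1⟩

theorem Feasible.sum_le_NCF {M : Finset (Finset Y)} {e : ∀ C : Finset Y, Assign C O → ℝ}
    {b : (Y → O) → ℝ} (hb : Feasible M e b) : ∑ g, b g ≤ NCF M e :=
  le_csSup (bddAbove_feasible_weights M e) ⟨b, hb, rfl⟩

theorem nonempty_feasible_weights {M : Finset (Finset Y)}
    {e : ∀ C : Finset Y, Assign C O → ℝ} (he : IsEmpiricalModel M e) :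
    {w | ∃ b : (Y → O) → ℝ, Feasible M e b ∧ ∑ g, b g = w}.Nonempty :=
  ⟨_, _, feasible_zero he, rfl⟩

theorem RestrictsTo.NCF_le {f : Y ↪ Z} {M : Finset (Finset Y)} {N : Finset (Finset Z)}
    {E : ∀ C : Finset Z, Assign C O → ℝ} {e : ∀ C : Finset Y, Assign C O → ℝ}
    (hE : RestrictsTo f M E e) (hN : IsEmpiricalModel N E) (hMN : ∀ C ∈ M, C.map f ∈ N) :
    NCF N E ≤ NCF M e := by
  refine csSup_le (nonempty_feasible_weights hN) ?_
  rintro _ ⟨b, hb, rfl⟩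
  rw [← sum_restrictAlong f b]
  refine Feasible.sum_le_NCF ⟨fun h => Finset.sum_nonneg fun g _ => hb.1 g, ?_, ?_⟩
  · rw [sum_restrictAlong]
    exact hb.2.1
  · intro C hC t
    obtain ⟨s, rfl⟩ := (assignMapEquiv f C O).surjective t
    rw [← margG_map, ← hE C hC]
    exact hb.2.2 _ (hMN C hC) s

theorem RestrictsTo.margG_le {f : Y ↪ Z} {M : Finset (Finset Y)}
    {E : ∀ C : Finset Z, Assign C O → ℝ} {e : ∀ C : Finset Y, Assign C O → ℝ}
    (hE : RestrictsTo f M E e) {b : (Z → O) → ℝ} {b' : (Y → O) → ℝ} (hb' : Feasible M e b')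
    (hle : ∀ h, restrictAlong f b h ≤ b' h) {C : Finset Y} (hC : C ∈ M)
    (s : Assign (C.map f) O) : margG (C.map f) b s ≤ E (C.map f) s := by
  rw [margG_map, hE C hC]
  exact (margG_mono C hle _).trans (hb'.2.2 C hC _)

end Embedding

section Choice

theorem apply_congr_context {Y O : Type} (e : ∀ C : Finset Y, Assign C O → ℝ) {C D : Finset Y}
    (h : D = C) (s : Assign C O) : e D (fun x => s ⟨x.1, h ▸ x.2⟩) = e C s := by
  subst h
  rfl

theorem map_inl_inter_map_inr {X₁ X₂ : Type} [DecidableEq X₁] [DecidableEq X₂] (C : Finset X₁)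
    (D : Finset X₂) :
    C.map ⟨Sum.inl, Sum.inl_injective⟩ ∩ D.map ⟨Sum.inr, Sum.inr_injective⟩ =
      (∅ : Finset (X₁ ⊕ X₂)) := by
  ext x
  cases x <;> simp

variable {X₁ X₂ O : Type} [Fintype X₁] [DecidableEq X₁] [Fintype X₂] [DecidableEq X₂]
  [Fintype O] [DecidableEq O]

theorem choiceModel_restrictsTo_inl {M₁ : Finset (Finset X₁)}
    {e₁ : ∀ C : Finset X₁, Assign C O → ℝ} (e₂ : ∀ C : Finset X₂, Assign C O → ℝ)
    (he₁ : IsEmpiricalModel M₁ e₁) :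
    RestrictsTo ⟨Sum.inl, Sum.inl_injective⟩ M₁ (choiceModel M₁ e₁ e₂) e₁ := by
  intro C hC s
  unfold choiceModel
  split_ifs with h h'
  · exact (he₁.apply_empty hC (Finset.map_eq_empty.mp h) _).symm
  · have hC' : (C.map ⟨Sum.inl, Sum.inl_injective⟩ : Finset (X₁ ⊕ X₂)).toLeft = C := by
      ext
      simp
    exact apply_congr_context e₁ hC' (assignMapEquiv _ C O s)
  · exact (h' (Finset.mem_image_of_mem _ hC)).elim

theorem choiceModel_restrictsTo_inr {M₁ : Finset (Finset X₁)} {M₂ : Finset (Finset X₂)}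
    (e₁ : ∀ C : Finset X₁, Assign C O → ℝ) {e₂ : ∀ C : Finset X₂, Assign C O → ℝ}
    (he₂ : IsEmpiricalModel M₂ e₂) :
    RestrictsTo ⟨Sum.inr, Sum.inr_injective⟩ M₂ (choiceModel M₁ e₁ e₂) e₂ := by
  intro C hC s
  unfold choiceModel
  split_ifs with h h'
  · exact (he₂.apply_empty hC (Finset.map_eq_empty.mp h) _).symm
  · obtain ⟨D, -, hD⟩ := Finset.mem_image.mp h'
    obtain ⟨x, hx⟩ := Finset.nonempty_iff_ne_empty.mpr h
    obtain ⟨y, -, rfl⟩ := Finset.mem_map.mp hx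
    rw [← hD] at hx
    simp at hx
  · have hC' : (C.map ⟨Sum.inr, Sum.inr_injective⟩ : Finset (X₁ ⊕ X₂)).toRight = C := by
      ext
      simp
    exact apply_congr_context e₂ hC' (assignMapEquiv _ C O s)

theorem isEmpiricalModel_choiceModel {M₁ : Finset (Finset X₁)} {M₂ : Finset (Finset X₂)}
    {e₁ : ∀ C : Finset X₁, Assign C O → ℝ} {e₂ : ∀ C : Finset X₂, Assign C O → ℝ}
    (he₁ : IsEmpiricalModel M₁ e₁) (he₂ : IsEmpiricalModel M₂ e₂) :
    IsEmpiricalModel (inlContexts M₁ ∪ inrContexts M₂) (choiceModel M₁ e₁ e₂) := by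
  have h₁ := choiceModel_restrictsTo_inl e₂ he₁
  have h₂ := choiceModel_restrictsTo_inr (M₁ := M₁) e₁ he₂
  have hprob : ∀ C ∈ inlContexts M₁ ∪ inrContexts M₂, IsProb (choiceModel M₁ e₁ e₂ C) := by
    intro C hC
    rcases Finset.mem_union.mp hC with hC | hC <;> obtain ⟨D, hD, rfl⟩ := Finset.mem_image.mp hC
    · exact h₁.isProb he₁ hD
    · exact h₂.isProb he₂ hD
  have hdisj : ∀ C ∈ inlContexts M₁ ∪ inrContexts M₂, ∀ C' ∈ inlContexts M₁ ∪ inrContexts M₂,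
      C ∩ C' = ∅ →
      marg (inter_subset_left : C ∩ C' ⊆ C) (choiceModel M₁ e₁ e₂ C) =
        marg (inter_subset_right : C ∩ C' ⊆ C') (choiceModel M₁ e₁ e₂ C') := by
    intro C hC C' hC' h
    funext t
    rw [marg_eq_sum_of_eq_empty h, marg_eq_sum_of_eq_empty h, (hprob C hC).2, (hprob C' hC').2]
  refine ⟨hprob, fun C hC C' hC' => ?_⟩
  have hd := hdisj C hC C' hC'
  rcases Finset.mem_union.mp hC with hC | hC <;> obtain ⟨D, hD, rfl⟩ := Finset.mem_image.mp hC <;>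
    rcases Finset.mem_union.mp hC' with hC' | hC' <;>
    obtain ⟨B, hB, rfl⟩ := Finset.mem_image.mp hC'
  · exact h₁.marg_inter_eq he₁ hD hB
  · exact hd (map_inl_inter_map_inr D B)
  · exact hd ((Finset.inter_comm _ _).trans (map_inl_inter_map_inr B D))
  · exact h₂.marg_inter_eq he₂ hD hB

/-- The product of two distributions on global assignments, normalised by the larger of the two
weights. -/
noncomputable def normalizedProd (b₁ : (X₁ → O) → ℝ) (b₂ : (X₂ → O) → ℝ) :
    (X₁ ⊕ X₂ → O) → ℝ :=
  fun g => b₁ (g ∘ Sum.inl) * b₂ (g ∘ Sum.inr) / max (∑ h, b₁ h) (∑ h, b₂ h)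

theorem restrictAlong_inl_normalizedProd (b₁ : (X₁ → O) → ℝ) (b₂ : (X₂ → O) → ℝ)
    (h : X₁ → O) :
    restrictAlong ⟨Sum.inl, Sum.inl_injective⟩ (normalizedProd b₁ b₂) h =
      b₁ h * ((∑ k, b₂ k) / max (∑ k, b₁ k) (∑ k, b₂ k)) := by
  rw [← mul_div_assoc, Finset.mul_sum, Finset.sum_div]
  refine Finset.sum_bij' (fun g _ => g ∘ Sum.inr) (fun k _ => Sum.elim h k) ?_ ?_ ?_ ?_ ?_
  · simp
  · intro k _
    simp only [mem_filter, mem_univ, true_and]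
    rfl
  · intro g hg
    rw [← (Finset.mem_filter.mp hg).2]
    exact Sum.elim_comp_inl_inr g
  · intro k _
    rfl
  · intro g hg
    rw [← (Finset.mem_filter.mp hg).2]
    rfl

theorem restrictAlong_inr_normalizedProd (b₁ : (X₁ → O) → ℝ) (b₂ : (X₂ → O) → ℝ)
    (h : X₂ → O) :
    restrictAlong ⟨Sum.inr, Sum.inr_injective⟩ (normalizedProd b₁ b₂) h =
      b₂ h * ((∑ k, b₁ k) / max (∑ k, b₁ k) (∑ k, b₂ k)) := by
  rw [← mul_div_assoc, Finset.mul_sum, Finset.sum_div]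
  refine Finset.sum_bij' (fun g _ => g ∘ Sum.inl) (fun k _ => Sum.elim k h) ?_ ?_ ?_ ?_ ?_
  · simp
  · intro k _
    simp only [mem_filter, mem_univ, true_and]
    rfl
  · intro g hg
    rw [← (Finset.mem_filter.mp hg).2]
    exact Sum.elim_comp_inl_inr g
  · intro k _
    rfl
  · intro g hg
    rw [← (Finset.mem_filter.mp hg).2, mul_comm]
    rfl

theorem sum_normalizedProd {b₁ : (X₁ → O) → ℝ} {b₂ : (X₂ → O) → ℝ}
    (h₁ : ∀ g, 0 ≤ b₁ g) (h₂ : ∀ g, 0 ≤ b₂ g) :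
    ∑ g, normalizedProd b₁ b₂ g = min (∑ g, b₁ g) (∑ g, b₂ g) := by
  rw [← sum_restrictAlong ⟨Sum.inl, Sum.inl_injective⟩]
  simp only [restrictAlong_inl_normalizedProd]
  rw [← Finset.sum_mul, ← mul_div_assoc, ← min_mul_max]
  have hs₁ : 0 ≤ ∑ g, b₁ g := Finset.sum_nonneg fun g _ => h₁ g
  have hs₂ : 0 ≤ ∑ g, b₂ g := Finset.sum_nonneg fun g _ => h₂ g
  refine mul_div_cancel_of_imp fun h => ?_
  exact le_antisymm (min_le_max.trans h.le) (le_min hs₁ hs₂)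

theorem feasible_normalizedProd {M₁ : Finset (Finset X₁)} {M₂ : Finset (Finset X₂)}
    {e₁ : ∀ C : Finset X₁, Assign C O → ℝ} {e₂ : ∀ C : Finset X₂, Assign C O → ℝ}
    (he₁ : IsEmpiricalModel M₁ e₁) (he₂ : IsEmpiricalModel M₂ e₂)
    {b₁ : (X₁ → O) → ℝ} {b₂ : (X₂ → O) → ℝ}
    (hb₁ : Feasible M₁ e₁ b₁) (hb₂ : Feasible M₂ e₂ b₂) :
    Feasible (inlContexts M₁ ∪ inrContexts M₂) (choiceModel M₁ e₁ e₂)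
      (normalizedProd b₁ b₂) := by
  have hs₁ : 0 ≤ ∑ g, b₁ g := Finset.sum_nonneg fun g _ => hb₁.1 g
  have hm : 0 ≤ max (∑ g, b₁ g) (∑ g, b₂ g) := le_max_of_le_left hs₁
  refine ⟨fun g => div_nonneg (mul_nonneg (hb₁.1 _) (hb₂.1 _)) hm, ?_, ?_⟩
  · rw [sum_normalizedProd hb₁.1 hb₂.1]
    exact min_le_of_left_le hb₁.2.1
  · intro C hC
    rcases Finset.mem_union.mp hC with hC | hC <;> obtain ⟨D, hD, rfl⟩ := Finset.mem_image.mp hC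
    · refine (choiceModel_restrictsTo_inl e₂ he₁).margG_le hb₁ (fun h => ?_) hD
      rw [restrictAlong_inl_normalizedProd]
      exact mul_le_of_le_one_right (hb₁.1 h) (div_le_one_of_le₀ (le_max_right _ _) hm)
    · refine (choiceModel_restrictsTo_inr e₁ he₂).margG_le hb₂ (fun h => ?_) hD
      rw [restrictAlong_inr_normalizedProd]
      exact mul_le_of_le_one_right (hb₂.1 h) (div_le_one_of_le₀ (le_max_left _ _) hm)

theorem NCF_choiceModel {M₁ : Finset (Finset X₁)} {M₂ : Finset (Finset X₂)}
    {e₁ : ∀ C : Finset X₁, Assign C O → ℝ} {e₂ : ∀ C : Finset X₂, Assign C O → ℝ}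
    (he₁ : IsEmpiricalModel M₁ e₁) (he₂ : IsEmpiricalModel M₂ e₂) :
    NCF (inlContexts M₁ ∪ inrContexts M₂) (choiceModel M₁ e₁ e₂) =
      min (NCF M₁ e₁) (NCF M₂ e₂) := by
  have he := isEmpiricalModel_choiceModel he₁ he₂
  refine le_antisymm (le_min ?_ ?_) (le_of_forall_lt fun w hw => ?_)
  · exact (choiceModel_restrictsTo_inl e₂ he₁).NCF_le he fun C hC =>
      Finset.mem_union_left _ (Finset.mem_image_of_mem _ hC)
  · exact (choiceModel_restrictsTo_inr e₁ he₂).NCF_le he fun C hC =>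
      Finset.mem_union_right _ (Finset.mem_image_of_mem _ hC)
  · obtain ⟨hw₁, hw₂⟩ := lt_min_iff.mp hw
    obtain ⟨_, ⟨b₁, hb₁, rfl⟩, hlt₁⟩ := exists_lt_of_lt_csSup (nonempty_feasible_weights he₁) hw₁
    obtain ⟨_, ⟨b₂, hb₂, rfl⟩, hlt₂⟩ := exists_lt_of_lt_csSup (nonempty_feasible_weights he₂) hw₂
    refine (lt_min hlt₁ hlt₂).trans_le ?_
    rw [← sum_normalizedProd hb₁.1 hb₂.1]
    exact (feasible_normalizedProd he₁ he₂ hb₁ hb₂).sum_le_NCF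

end Choice

/-- **Theorem 2, controlled choice.** The controlled choice `e₁ & e₂` is
an empirical model on `(X₁ ⊔ X₂, M₁ ⊔ M₂, O)` and
`NCF(e₁ & e₂) = min(NCF(e₁), NCF(e₂))`, equivalently
`CF(e₁ & e₂) = max(CF(e₁), CF(e₂))`. -/
theorem contextual_fraction_controlled_choice
    {X₁ X₂ O : Type} [Fintype X₁] [DecidableEq X₁] [Fintype X₂] [DecidableEq X₂]
    [Fintype O] [DecidableEq O] [Nonempty O]
    (M₁ : Finset (Finset X₁)) (M₂ : Finset (Finset X₂))
    (e₁ : ∀ C₁ : Finset X₁, Assign C₁ O → ℝ) (e₂ : ∀ C₂ : Finset X₂, Assign C₂ O → ℝ)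
    (he₁ : IsEmpiricalModel M₁ e₁) (he₂ : IsEmpiricalModel M₂ e₂) :
    IsEmpiricalModel (inlContexts M₁ ∪ inrContexts M₂) (choiceModel M₁ e₁ e₂) ∧
    NCF (inlContexts M₁ ∪ inrContexts M₂) (choiceModel M₁ e₁ e₂) =
      min (NCF M₁ e₁) (NCF M₂ e₂) ∧
    CF (inlContexts M₁ ∪ inrContexts M₂) (choiceModel M₁ e₁ e₂) =
      max (CF M₁ e₁) (CF M₂ e₂) := by
  refine ⟨isEmpiricalModel_choiceModel he₁ he₂, NCF_choiceModel he₁ he₂, ?_⟩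
  rw [CF, CF, CF, NCF_choiceModel he₁ he₂]
  exact (max_sub_sub_left 1 _ _).symm
end
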